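/- Let M be a definite multi-context system with grounded equilibrium S, and let M_just be a justification of a belief set S_i of S. Then every bridge rule of M_just is satisfied in the grounded equilibrium of M_just. -/

import Mathlib

/-- A bridge rule of a definite MCS: a head literal and a finite positive body. -/
structure Rule (n : ℕ) (α : Type*) where
  head : α
  body : Finset (Fin n × α)
deriving DecidableEq

/-- A definite multi-context system: for each context, a monotone semantic
operator and a finite set of bridge rules. -/
structure MCS (n : ℕ) (α : Type*) [DecidableEq α] where
  ACC : Fin n → Finset α → Finset α
  mono : ∀ i, Monotone (ACC i)
  br : Fin n → Finset (Rule n α)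

variable {n : ℕ} {α : Type*} [DecidableEq α]

/-- A bridge rule is satisfied in a belief state `S` iff every body literal holds. -/
def Satisfied (r : Rule n α) (S : Fin n → Finset α) : Prop :=
  ∀ cp ∈ r.body, cp.2 ∈ S cp.1

instance (r : Rule n α) (S : Fin n → Finset α) : Decidable (Satisfied r S) := by
  unfold Satisfied; infer_instance

/-- The knowledge base induced at context `i` by belief state `S`:
the heads of the bridge rules of context `i` satisfied in `S`. -/
def kbOf (M : MCS n α) (S : Fin n → Finset α) (i : Fin n) : Finset α :=
  ((M.br i).filter (fun r => Satisfied r S)).image Rule.head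

/-- A belief state is an equilibrium iff each belief set is the result of
applying the semantic operator to the induced knowledge base. -/
def IsEquilibrium (M : MCS n α) (S : Fin n → Finset α) : Prop :=
  ∀ i, S i = M.ACC i (kbOf M S i)

/-- The grounded equilibrium: the pointwise-⊆-least equilibrium. -/
def IsGrounded (M : MCS n α) (S : Fin n → Finset α) : Prop :=
  IsEquilibrium M S ∧ ∀ E, IsEquilibrium M E → ∀ i, S i ⊆ E i

/-- `M'` is a fragment of `M`: same contexts and operators, fewer bridge rules. -/
def Fragment (M' M : MCS n α) : Prop :=
  M'.ACC = M.ACC ∧ ∀ i, M'.br i ⊆ M.br i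

/-- The defining conditions of a justification of the belief set `S i` (w.r.t. the
grounded equilibrium `S` of the ambient MCS): the fragment has a grounded equilibrium
`S'` with `S' i = S i` and `S' j ⊆ S j` for all `j ≠ i`. -/
def JustCond (M' : MCS n α) (S : Fin n → Finset α) (i : Fin n) : Prop :=
  ∃ S' : Fin n → Finset α, IsGrounded M' S' ∧ S' i = S i ∧ ∀ j, j ≠ i → S' j ⊆ S j

/-- `M'` is a justification of the belief set `S i` of the grounded equilibrium `S`
of `M`: a fragment of `M` satisfying the justification conditions such that no
strictly smaller fragment (componentwise on bridge-rule sets) satisfies them. -/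
def IsJustification (M' M : MCS n α) (S : Fin n → Finset α) (i : Fin n) : Prop :=
  Fragment M' M ∧ JustCond M' S i ∧
  ∀ M'' : MCS n α, Fragment M'' M' → M''.br ≠ M'.br → ¬ JustCond M'' S i

theorem Satisfied.mono {β : Type*} {r : Rule n β} {S T : Fin n → Finset β} (h : S ≤ T)
    (hr : Satisfied r S) : Satisfied r T :=
  fun cp hcp => h cp.1 (hr cp hcp)

theorem kbOf_mono (M : MCS n α) {S T : Fin n → Finset α} (h : S ≤ T) (i : Fin n) :
    kbOf M S i ⊆ kbOf M T i :=
  Finset.image_subset_image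
    (Finset.monotone_filter_right _ fun _ _ hr => hr.mono h)

/-- Every belief state closed under one step of the system lies above an equilibrium. -/
theorem exists_isEquilibrium_le (M : MCS n α) {F : Fin n → Finset α}
    (hF : ∀ i, M.ACC i (kbOf M F i) ⊆ F i) : ∃ E ≤ F, IsEquilibrium M E := by
  obtain ⟨P, hPF, hP⟩ := exists_minimal_le_of_wellFoundedLT
    (fun X : Fin n → Finset α => ∀ i, M.ACC i (kbOf M X i) ⊆ X i) F hF
  refine ⟨P, hPF, fun i => ?_⟩
  have hle : (fun i => M.ACC i (kbOf M P i)) ≤ P := hP.prop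
  exact (hP.le_of_le (fun j => M.mono j (kbOf_mono M hle j)) hle i).antisymm (hle i)

theorem IsGrounded.unique {M : MCS n α} {S T : Fin n → Finset α}
    (hS : IsGrounded M S) (hT : IsGrounded M T) : S = T :=
  funext fun i => (hS.2 T hT.1 i).antisymm (hT.2 S hS.1 i)

/-- The fragment of `M` consisting of the bridge rules satisfied in `S`. -/
def MCS.restrict (M : MCS n α) (S : Fin n → Finset α) : MCS n α where
  ACC := M.ACC
  mono := M.mono
  br i := (M.br i).filter fun r => Satisfied r S

theorem kbOf_restrict_of_le (M : MCS n α) {S T : Fin n → Finset α} (h : T ≤ S) (i : Fin n) :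
    kbOf (M.restrict S) T i = kbOf M T i := by
  simp only [kbOf, MCS.restrict, Finset.filter_filter]
  congr 1
  exact Finset.filter_congr fun r _ => ⟨fun hr => hr.2, fun hr => ⟨hr.mono h, hr⟩⟩

/-- Dropping the bridge rules not satisfied in the grounded equilibrium preserves it. -/
theorem IsGrounded.restrict {M : MCS n α} {S : Fin n → Finset α} (hS : IsGrounded M S) :
    IsGrounded (M.restrict S) S := by
  refine ⟨fun i => ?_, fun E hE => ?_⟩
  · rw [kbOf_restrict_of_le M le_rfl]
    exact hS.1 i
  · obtain ⟨P, hPF, hP⟩ := exists_isEquilibrium_le M (F := E ⊓ S) fun i => by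
      refine Finset.subset_inter ?_ ?_
      · rw [← kbOf_restrict_of_le M inf_le_right, hE i]
        exact M.mono i (kbOf_mono _ inf_le_left i)
      · rw [hS.1 i]
        exact M.mono i (kbOf_mono _ inf_le_right i)
    exact fun i => (hS.2 P hP i).trans ((hPF.trans inf_le_left) i)

/-- every bridge rule of a justification `M_just` of a belief set `S i`
of the grounded equilibrium `S` of `M` is satisfied in the grounded equilibrium of
`M_just`. -/
theorem justification_rules_satisfied (M M_just : MCS n α) (S S' : Fin n → Finset α)
    (hS : IsGrounded M S) (i : Fin n)
    (hJ : IsJustification M_just M S i)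
    (hS' : IsGrounded M_just S') :
    ∀ j, ∀ r ∈ M_just.br j, Satisfied r S' := by
  obtain ⟨-, ⟨T, hT, hTi, hTj⟩, hmin⟩ := hJ
  obtain rfl := hT.unique hS'
  intro j r hr
  by_contra hsat
  refine hmin (M_just.restrict T) ⟨rfl, fun _ => Finset.filter_subset _ _⟩ (fun heq => ?_)
    ⟨T, hT.restrict, hTi, hTj⟩
  rw [← heq] at hr
  exact hsat (Finset.mem_filter.1 hr).2
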